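/- Let μ = (μ_1,…,μ_{n/2}) be the random vector with joint density Z_n^{-1}|Δ(μ)|² e^{−Σ_{j=1}^{n/2} μ_j²/2} on Σ_n, and γ_n ∈ X the associated random element. Then for every x ∈ X, lim_{ε→0+} limsup_{n→∞, n even} (4/n²) ln P(d(γ_n, x) < ε) ≤ 1 − x_0 + ln J(x) = −I(x), where ln 0 is interpreted as −∞ (the limit in ε exists since limsup_{n} (4/n²) ln P(d(γ_n,x)<ε) is increasing in ε). -/

import Mathlib

open MeasureTheory BoundedContinuousFunction Filter

noncomputable section

/-- Membership in the space `X ⊆ l^∞`: `x_j ≥ x_{j+1} ≥ 0` for `j ≥ 1` and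
`Σ_{j=1}^∞ x_j² ≤ x_0` (the series being summable). Bounded sequences are modeled as
bounded (continuous) functions `ℕ →ᵇ ℝ`, whose distance is the sup metric `d`. -/
def memX (x : ℕ →ᵇ ℝ) : Prop :=
  (∀ j : ℕ, 1 ≤ j → 0 ≤ x (j + 1) ∧ x (j + 1) ≤ x j) ∧
  Summable (fun j : ℕ => (x (j + 1)) ^ 2) ∧ (∑' j : ℕ, (x (j + 1)) ^ 2) ≤ x 0

def setX : Set (ℕ →ᵇ ℝ) := {x | memX x}

/-- `J(x) = x_0 − Σ_{j=1}^∞ x_j²`. -/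
def Jfun (x : ℕ →ᵇ ℝ) : ℝ := x 0 - ∑' j : ℕ, (x (j + 1)) ^ 2

/-- The rate function `I(x) = x_0 − 1 − ln J(x)` for `J(x) > 0`, and `+∞` when `J(x) = 0`. -/
def Ifun (x : ℕ →ᵇ ℝ) : EReal :=
  if 0 < Jfun x then ((x 0 - 1 - Real.log (Jfun x) : ℝ) : EReal) else ⊤

/-- The open Weyl chamber `Σ_n`: strictly decreasing positive vectors. -/
def SigmaN (m : ℕ) : Set (Fin m → ℝ) :=
  {μ | (∀ i j : Fin m, i < j → μ j < μ i) ∧ ∀ i, 0 < μ i}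

/-- The Vandermonde-type determinant `Δ(μ) = ∏_{i<j} (μ_i² − μ_j²)`. -/
def VdM (m : ℕ) (μ : Fin m → ℝ) : ℝ :=
  ∏ p ∈ Finset.univ.filter (fun p : Fin m × Fin m => p.1 < p.2), (μ p.1 ^ 2 - μ p.2 ^ 2)

/-- The normalization constant `Z_n = (π/2)^{n/4} ∏_{j=0}^{n/2−1} (2j)!`. -/
def Zn (n : ℕ) : ℝ :=
  (Real.pi / 2) ^ ((n : ℝ) / 4) * ∏ j ∈ Finset.range (n / 2), (Nat.factorial (2 * j) : ℝ)

/-- The law of `μ = (μ_1, …, μ_{n/2})`: the probability measure on `ℝ^{n/2}` with density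
`Z_n^{-1} |Δ(μ)|² e^{−Σ μ_j²/2}` on `Σ_{n}` with respect to Lebesgue measure. -/
def Pn (n : ℕ) : Measure (Fin (n / 2) → ℝ) :=
  (volume.restrict (SigmaN (n / 2))).withDensity
    (fun μ => ENNReal.ofReal ((Zn n)⁻¹ * (VdM (n / 2) μ) ^ 2 * Real.exp (-(∑ j, μ j ^ 2) / 2)))

/-- `γ` is the family of random elements `γ_n ∈ X` associated with `μ`:
`(γ_n)_0 = C(n,2)^{-1} Σ_j μ_j²`, `(γ_n)_j = C(n,2)^{-1/2} μ_j` for `1 ≤ j ≤ n/2`, and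
`(γ_n)_j = 0` for `j > n/2` (characterized on `Σ_n`, which has full `Pn`-measure). -/
def IsGammaN (γ : (n : ℕ) → (Fin (n / 2) → ℝ) → (ℕ →ᵇ ℝ)) : Prop :=
  ∀ n : ℕ, Even n → 0 < n → ∀ μ ∈ SigmaN (n / 2),
    γ n μ ∈ setX ∧
    (γ n μ) 0 = (n.choose 2 : ℝ)⁻¹ * ∑ j, μ j ^ 2 ∧
    (∀ j : Fin (n / 2), (γ n μ) ((j : ℕ) + 1) = (Real.sqrt (n.choose 2))⁻¹ * μ j) ∧
    (∀ j : ℕ, n / 2 < j → (γ n μ) j = 0)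

open Polynomial in
lemma integrable_eval_mul_gaussian (p : ℝ[X]) :
    Integrable fun x : ℝ => p.eval x * Real.exp (-x ^ 2 / 2) := by
  induction p using Polynomial.induction_on' with
  | add p q hp hq =>
    simp only [eval_add, add_mul]
    exact hp.add hq
  | monomial n a =>
    have h := (integrable_rpow_mul_exp_neg_mul_sq (b := 1 / 2) (by norm_num) (s := n)
      (by linarith [n.cast_nonneg (α := ℝ)])).const_mul a
    refine h.congr (ae_of_all _ fun x => ?_)
    simp only [eval_monomial, Real.rpow_natCast, mul_assoc]
    ring_nf

/-- The probabilists' Hermite polynomials with real coefficients. -/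
def realHermite (n : ℕ) : Polynomial ℝ := (Polynomial.hermite n).map (Int.castRingHom ℝ)

open Polynomial in
lemma realHermite_succ (n : ℕ) :
    realHermite (n + 1) = X * realHermite n - derivative (realHermite n) := by
  simp [realHermite, hermite_succ, derivative_map]

lemma realHermite_monic (n : ℕ) : (realHermite n).Monic := (Polynomial.hermite_monic n).map _

lemma natDegree_realHermite (n : ℕ) : (realHermite n).natDegree = n := by
  rw [realHermite, (Polynomial.hermite_monic n).natDegree_map, Polynomial.natDegree_hermite]

open Polynomial in
lemma integral_realHermite_succ_mul (n : ℕ) (p : ℝ[X]) :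
    ∫ x : ℝ, (realHermite (n + 1) * p).eval x * Real.exp (-x ^ 2 / 2) =
      ∫ x : ℝ, (realHermite n * derivative p).eval x * Real.exp (-x ^ 2 / 2) := by
  rw [← sub_eq_zero, ← integral_sub (integrable_eval_mul_gaussian _)
    (integrable_eval_mul_gaussian _)]
  refine integral_eq_zero_of_hasDerivAt_of_integrable
    (f := fun x => (-(realHermite n * p)).eval x * Real.exp (-x ^ 2 / 2)) (fun x => ?_)
    ((integrable_eval_mul_gaussian _).sub (integrable_eval_mul_gaussian _))
    (integrable_eval_mul_gaussian _)
  have h1 : HasDerivAt (fun x : ℝ => Real.exp (-x ^ 2 / 2)) (Real.exp (-x ^ 2 / 2) * (-x)) x := by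
    refine HasDerivAt.exp ?_
    refine (((hasDerivAt_pow 2 x).fun_neg).div_const 2).congr_deriv ?_
    push_cast
    ring
  refine ((Polynomial.hasDerivAt (-(realHermite n * p)) x).mul h1).congr_deriv ?_
  simp only [realHermite_succ, derivative_neg, derivative_mul, eval_neg, eval_add, eval_mul,
    eval_sub, eval_X]
  ring

open Polynomial in
lemma integral_realHermite_mul (n : ℕ) (p : ℝ[X]) :
    ∫ x : ℝ, (realHermite n * p).eval x * Real.exp (-x ^ 2 / 2) =
      ∫ x : ℝ, (derivative^[n] p).eval x * Real.exp (-x ^ 2 / 2) := by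
  induction n generalizing p with
  | zero => simp [realHermite]
  | succ n ih => rw [integral_realHermite_succ_mul, ih, Function.iterate_succ_apply]

lemma integral_exp_neg_sq_div_two :
    ∫ x : ℝ, Real.exp (-x ^ 2 / 2) = Real.sqrt (2 * Real.pi) := by
  have h := integral_gaussian (1 / 2)
  rw [show Real.pi / (1 / 2) = 2 * Real.pi by ring] at h
  rw [← h]
  congr 1 with x
  ring_nf

open Polynomial in
lemma integral_realHermite_mul_realHermite (n k : ℕ) :
    ∫ x : ℝ, (realHermite n).eval x * (realHermite k).eval x * Real.exp (-x ^ 2 / 2) =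
      if n = k then Real.sqrt (2 * Real.pi) * (n.factorial : ℝ) else 0 := by
  have lt_case : ∀ n k : ℕ, k < n →
      ∫ x : ℝ, (realHermite n).eval x * (realHermite k).eval x * Real.exp (-x ^ 2 / 2) = 0 := by
    intro n k hkn
    simp only [← eval_mul]
    rw [integral_realHermite_mul, iterate_derivative_eq_zero (by rwa [natDegree_realHermite])]
    simp
  rcases lt_trichotomy n k with h | rfl | h
  · rw [if_neg h.ne, ← lt_case k n h]
    simp only [mul_comm]
  · have hd : derivative^[n] (realHermite n) = C (n.factorial : ℝ) := by
      have hdeg := natDegree_iterate_derivative (realHermite n) n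
      rw [natDegree_realHermite, Nat.sub_self] at hdeg
      rw [eq_C_of_natDegree_le_zero hdeg, coeff_iterate_derivative]
      have := (realHermite_monic n).coeff_natDegree
      rw [natDegree_realHermite] at this
      simp [this, Nat.descFactorial_self]
    simp only [← eval_mul]
    rw [integral_realHermite_mul, hd, if_pos trivial]
    simp only [eval_C]
    rw [integral_const_mul, integral_exp_neg_sq_div_two, mul_comm]
  · rw [if_neg h.ne', lt_case n k h]

open Polynomial in
/-- `Δ(μ)` as a determinant of even Hermite polynomials, up to sign. -/
lemma VdM_sq_eq_det_sq (m : ℕ) (μ : Fin m → ℝ) :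
    VdM m μ ^ 2 = (Matrix.of fun i j : Fin m => (realHermite (2 * j)).eval (μ i)).det ^ 2 := by
  have hcoeff : ∀ j i : ℕ, ((realHermite (2 * j)).contract 2).coeff i =
      (realHermite (2 * j)).coeff (i * 2) := fun j i => coeff_contract two_ne_zero _ _
  have heval : ∀ (j : ℕ) (y : ℝ), ((realHermite (2 * j)).contract 2).eval (y ^ 2) =
      (realHermite (2 * j)).eval y := by
    intro j y
    rw [← expand_eval]
    congr 1
    ext i
    rw [coeff_expand two_pos]
    split_ifs with h
    · rw [hcoeff, Nat.div_mul_cancel h]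
    · have : Odd (2 * j + i) := by
        rw [← Nat.not_even_iff_odd]
        intro h'
        apply h
        have := h'.two_dvd
        omega
      simp [realHermite, coeff_map, coeff_hermite_of_odd_add this]
  have hlead : ∀ j : ℕ, ((realHermite (2 * j)).contract 2).coeff j = 1 := by
    intro j
    have := (realHermite_monic (2 * j)).coeff_natDegree
    rw [natDegree_realHermite] at this
    rw [hcoeff, mul_comm j 2, this]
  have hle : ∀ j : ℕ, ((realHermite (2 * j)).contract 2).natDegree ≤ j := by
    intro j
    rw [natDegree_le_iff_coeff_eq_zero]
    intro N hN
    rw [hcoeff]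
    apply coeff_eq_zero_of_natDegree_lt
    rw [natDegree_realHermite]
    omega
  have hdeg : ∀ j : ℕ, ((realHermite (2 * j)).contract 2).natDegree = j := fun j =>
    le_antisymm (hle j) (le_natDegree_of_ne_zero (by rw [hlead]; exact one_ne_zero))
  have hdet := Matrix.det_eval_matrixOfPolynomials_eq_det_vandermonde (fun i => μ i ^ 2)
    (fun j : Fin m => (realHermite (2 * j)).contract 2) (fun j => hdeg j)
    (fun j => by rw [Monic, leadingCoeff, hdeg, hlead])
  simp only [heval] at hdet
  rw [← hdet, Matrix.det_vandermonde, VdM, ← Finset.prod_pow, ← Finset.prod_pow,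
    Finset.prod_filter, ← Finset.univ_product_univ, Finset.prod_product]
  refine Finset.prod_congr rfl fun i _ => ?_
  rw [← Finset.prod_pow, ← Finset.filter_lt_eq_Ioi, Finset.prod_filter]
  refine Finset.prod_congr rfl fun j _ => ?_
  split_ifs
  · ring
  · rfl

lemma VdM_sq_mul_exp_eq_sum (m : ℕ) (μ : Fin m → ℝ) :
    VdM m μ ^ 2 * Real.exp (-(∑ j, μ j ^ 2) / 2) =
      ∑ σ : Equiv.Perm (Fin m), ∑ τ : Equiv.Perm (Fin m),
        ((Equiv.Perm.sign σ : ℤ) : ℝ) * ((Equiv.Perm.sign τ : ℤ) : ℝ) *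
        ∏ i, ((realHermite (2 * σ i)).eval (μ i) * (realHermite (2 * τ i)).eval (μ i) *
          Real.exp (-μ i ^ 2 / 2)) := by
  have hexp : Real.exp (-(∑ j, μ j ^ 2) / 2) = ∏ i, Real.exp (-μ i ^ 2 / 2) := by
    rw [← Real.exp_sum, ← Finset.sum_div, Finset.sum_neg_distrib]
  rw [VdM_sq_eq_det_sq, ← Matrix.det_transpose, Matrix.det_apply', sq, Finset.sum_mul_sum,
    Finset.sum_mul, hexp]
  refine Finset.sum_congr rfl fun σ _ => ?_
  rw [Finset.sum_mul]
  refine Finset.sum_congr rfl fun τ _ => ?_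
  simp only [Matrix.transpose_apply, Matrix.of_apply, Finset.prod_mul_distrib]
  ring

lemma integrable_hermite_product (m : ℕ) (σ τ : Equiv.Perm (Fin m)) :
    Integrable fun μ : Fin m → ℝ =>
      ∏ i, ((realHermite (2 * σ i)).eval (μ i) * (realHermite (2 * τ i)).eval (μ i) *
          Real.exp (-μ i ^ 2 / 2)) := by
  refine Integrable.fintype_prod (f := fun i y => (realHermite (2 * σ i)).eval y *
    (realHermite (2 * τ i)).eval y * Real.exp (-y ^ 2 / 2)) fun i => ?_
  simpa using integrable_eval_mul_gaussian (realHermite (2 * σ i) * realHermite (2 * τ i))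

lemma integrable_VdM_sq_mul_exp (m : ℕ) :
    Integrable fun μ : Fin m → ℝ => VdM m μ ^ 2 * Real.exp (-(∑ j, μ j ^ 2) / 2) := by
  simp only [VdM_sq_mul_exp_eq_sum]
  exact integrable_finsetSum _ fun σ _ => integrable_finsetSum _ fun τ _ =>
    (integrable_hermite_product m σ τ).const_mul _

lemma integral_VdM_sq_mul_exp (m : ℕ) :
    ∫ μ : Fin m → ℝ, VdM m μ ^ 2 * Real.exp (-(∑ j, μ j ^ 2) / 2) =
      m.factorial * ∏ j ∈ Finset.range m, (Real.sqrt (2 * Real.pi) * ((2 * j).factorial : ℝ)) := by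
  simp only [VdM_sq_mul_exp_eq_sum]
  rw [integral_finsetSum _ fun σ _ => integrable_finsetSum _ fun τ _ =>
    (integrable_hermite_product m σ τ).const_mul _]
  have hterm : ∀ σ : Equiv.Perm (Fin m), (∫ μ : Fin m → ℝ, ∑ τ : Equiv.Perm (Fin m),
        ((Equiv.Perm.sign σ : ℤ) : ℝ) * ((Equiv.Perm.sign τ : ℤ) : ℝ) *
        ∏ i, ((realHermite (2 * σ i)).eval (μ i) * (realHermite (2 * τ i)).eval (μ i) *
          Real.exp (-μ i ^ 2 / 2))) =
      ∏ j ∈ Finset.range m, (Real.sqrt (2 * Real.pi) * ((2 * j).factorial : ℝ)) := by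
    intro σ
    rw [integral_finsetSum _ fun τ _ => (integrable_hermite_product m σ τ).const_mul _]
    simp only [integral_const_mul]
    have hprod : ∀ τ : Equiv.Perm (Fin m), (∫ μ : Fin m → ℝ,
        ∏ i, ((realHermite (2 * σ i)).eval (μ i) * (realHermite (2 * τ i)).eval (μ i) *
          Real.exp (-μ i ^ 2 / 2))) = ∏ i, (if 2 * (σ i : ℕ) = 2 * (τ i : ℕ) then
            Real.sqrt (2 * Real.pi) * ((2 * (σ i : ℕ)).factorial : ℝ) else 0) := by
      intro τ
      rw [integral_fintype_prod_volume_eq_prod (fun i y => (realHermite (2 * σ i)).eval y *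
        (realHermite (2 * τ i)).eval y * Real.exp (-y ^ 2 / 2))]
      simp only [integral_realHermite_mul_realHermite]
    simp only [hprod]
    rw [Finset.sum_eq_single σ]
    · have hsign : ((Equiv.Perm.sign σ : ℤ) : ℝ) * ((Equiv.Perm.sign σ : ℤ) : ℝ) = 1 := by
        rw [← Int.cast_mul, ← Units.val_mul, Int.units_mul_self]
        simp
      simp only [hsign, one_mul, if_true]
      rw [Equiv.prod_comp σ (fun i : Fin m =>
        Real.sqrt (2 * Real.pi) * ((2 * (i : ℕ)).factorial : ℝ)), Finset.prod_range]
    · intro τ _ hτ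
      obtain ⟨i, hi⟩ : ∃ i, σ i ≠ τ i := by
        by_contra! h
        exact hτ (Equiv.ext fun i => (h i).symm)
      rw [Finset.prod_eq_zero (Finset.mem_univ i), mul_zero]
      rw [if_neg]
      intro h
      exact hi (Fin.ext (by omega))
    · simp
  rw [Finset.sum_congr rfl fun σ _ => hterm σ]
  simp [Fintype.card_perm]

lemma VdM_eq_prod_prod (m : ℕ) (μ : Fin m → ℝ) :
    VdM m μ = ∏ i, ∏ j, if i < j then μ i ^ 2 - μ j ^ 2 else 1 := by
  rw [VdM, Finset.prod_filter, ← Finset.univ_product_univ, Finset.prod_product]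

lemma VdM_smul (m : ℕ) (c : ℝ) (μ : Fin m → ℝ) :
    VdM m (c • μ) = c ^ (m * (m - 1)) * VdM m μ := by
  have hcard : (Finset.univ.filter fun p : Fin m × Fin m => p.1 < p.2).card * 2 = m * (m - 1) := by
    rw [← Finset.sum_range_id_mul_two, ← Finset.sum_range_reflect, Finset.sum_range,
      Finset.card_filter, ← Finset.univ_product_univ, Finset.sum_product]
    congr 1
    refine Finset.sum_congr rfl fun i _ => ?_
    rw [← Finset.card_filter, Finset.filter_lt_eq_Ioi, Fin.card_Ioi]
  rw [← hcard, mul_comm _ 2, pow_mul, VdM, VdM, ← Finset.prod_const, ← Finset.prod_mul_distrib]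
  refine Finset.prod_congr rfl fun p _ => ?_
  simp only [Pi.smul_apply, smul_eq_mul]
  ring

lemma continuous_VdM (m : ℕ) : Continuous (VdM m) := by
  unfold VdM
  fun_prop

/-- The integral of `Δ(μ)² e^{-Σ μ_j²/2}` over the whole space `ℝ^m`. -/
def gaussVdM (m : ℕ) : ℝ :=
  m.factorial * ∏ j ∈ Finset.range m, (Real.sqrt (2 * Real.pi) * ((2 * j).factorial : ℝ))

lemma lintegral_VdM_sq_mul_exp_scaled (m : ℕ) {t : ℝ} (ht : 0 < t) :
    ∫⁻ μ : Fin m → ℝ, ENNReal.ofReal (VdM m μ ^ 2 * Real.exp (-(t * ∑ j, μ j ^ 2) / 2)) =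
      ENNReal.ofReal ((Real.sqrt t ^ (m + 2 * (m * (m - 1))))⁻¹ * gaussVdM m) := by
  have hs : 0 < Real.sqrt t := Real.sqrt_pos.2 ht
  set f : (Fin m → ℝ) → ℝ := fun μ => VdM m μ ^ 2 * Real.exp (-(∑ j, μ j ^ 2) / 2) with hf
  have hpoint : ∀ μ : Fin m → ℝ, VdM m μ ^ 2 * Real.exp (-(t * ∑ j, μ j ^ 2) / 2) =
      (Real.sqrt t ^ (2 * (m * (m - 1))))⁻¹ * f (Real.sqrt t • μ) := by
    intro μ
    simp only [hf, VdM_smul, Pi.smul_apply, smul_eq_mul, mul_pow, Real.sq_sqrt ht.le,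
      ← Finset.mul_sum]
    rw [← pow_mul, mul_comm (m * (m - 1)) 2]
    have : Real.sqrt t ^ (2 * (m * (m - 1))) ≠ 0 := by positivity
    field_simp
  have hint : Integrable fun μ : Fin m → ℝ => f (Real.sqrt t • μ) :=
    (integrable_VdM_sq_mul_exp m).comp_smul hs.ne'
  simp only [hpoint]
  rw [← ofReal_integral_eq_lintegral_ofReal (hint.const_mul _)
    (ae_of_all _ fun μ => by simp only [Pi.zero_apply, hf]; positivity), integral_const_mul,
    Measure.integral_comp_smul_of_nonneg volume f _ (hR := hs.le), integral_VdM_sq_mul_exp]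
  simp only [Module.finrank_fin_fun, smul_eq_mul, pow_add, mul_inv, gaussVdM]
  congr 1
  ring

lemma lintegral_fin_add_mul (k l : ℕ) {f : (Fin k → ℝ) → ENNReal} {g : (Fin l → ℝ) → ENNReal}
    (hf : Measurable f) (hg : Measurable g) :
    ∫⁻ μ : Fin (k + l) → ℝ, f (fun i => μ (Fin.castAdd l i)) * g (fun i => μ (Fin.natAdd k i)) =
      (∫⁻ μ, f μ) * ∫⁻ μ, g μ := by
  have h1 := volume_measurePreserving_piCongrLeft (fun _ : Fin (k + l) => ℝ) finSumFinEquiv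
  have h2 := volume_measurePreserving_sumPiEquivProdPi_symm (fun _ : Fin k ⊕ Fin l => ℝ)
  rw [← h1.lintegral_comp_emb (MeasurableEquiv.measurableEmbedding _),
    ← h2.lintegral_comp_emb (MeasurableEquiv.measurableEmbedding _),
    ← lintegral_prod_mul hf.aemeasurable hg.aemeasurable]
  refine lintegral_congr fun p => ?_
  have hl : ∀ (v : Fin k ⊕ Fin l → ℝ) (i : Fin k), MeasurableEquiv.piCongrLeft
      (fun _ : Fin (k + l) => ℝ) finSumFinEquiv v (Fin.castAdd l i) = v (Sum.inl i) := fun v i => by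
    rw [← finSumFinEquiv_apply_left]
    exact Equiv.piCongrLeft_apply_apply (fun _ : Fin (k + l) => ℝ) finSumFinEquiv v _
  have hr : ∀ (v : Fin k ⊕ Fin l → ℝ) (i : Fin l), MeasurableEquiv.piCongrLeft
      (fun _ : Fin (k + l) => ℝ) finSumFinEquiv v (Fin.natAdd k i) = v (Sum.inr i) := fun v i => by
    rw [← finSumFinEquiv_apply_right]
    exact Equiv.piCongrLeft_apply_apply (fun _ : Fin (k + l) => ℝ) finSumFinEquiv v _
  simp only [hl, hr]
  rfl

lemma VdM_sq_le (k l : ℕ) {R : ℝ} (hR : 1 ≤ R) (μ : Fin (k + l) → ℝ)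
    (hμ : ∀ i, 0 ≤ μ i ∧ μ i ≤ R) :
    VdM (k + l) μ ^ 2 ≤
      R ^ (4 * ((k + l) * k)) * VdM l (fun i => μ (Fin.natAdd k i)) ^ 2 := by
  have hR1 : (1 : ℝ) ≤ R ^ 4 := one_le_pow₀ hR
  have hfac : ∀ i j : Fin (k + l), (if i < j then μ i ^ 2 - μ j ^ 2 else 1) ^ 2 ≤ R ^ 4 := by
    intro i j
    split_ifs
    · have h1 : μ i ^ 2 ≤ R ^ 2 := pow_le_pow_left₀ (hμ i).1 (hμ i).2 2
      have h2 : μ j ^ 2 ≤ R ^ 2 := pow_le_pow_left₀ (hμ j).1 (hμ j).2 2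
      have : |μ i ^ 2 - μ j ^ 2| ≤ R ^ 2 :=
        abs_le.2 ⟨by linarith [sq_nonneg (μ i)], by linarith [sq_nonneg (μ j)]⟩
      calc _ = |μ i ^ 2 - μ j ^ 2| ^ 2 := (sq_abs _).symm
        _ ≤ (R ^ 2) ^ 2 := pow_le_pow_left₀ (abs_nonneg _) this 2
        _ = _ := by ring
    · simpa using hR1
  have hlow : (∏ i : Fin l, ∏ j : Fin (k + l), if Fin.natAdd k i < j then
      μ (Fin.natAdd k i) ^ 2 - μ j ^ 2 else 1) = VdM l (fun i => μ (Fin.natAdd k i)) := by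
    rw [VdM_eq_prod_prod]
    refine Finset.prod_congr rfl fun i _ => ?_
    rw [Fin.prod_univ_add]
    have : ∀ j : Fin k, ¬ Fin.natAdd k i < Fin.castAdd l j := by
      intro j h
      rw [Fin.lt_def] at h
      simp at h
      omega
    simp [this]
  rw [VdM_eq_prod_prod, Fin.prod_univ_add, hlow, mul_pow]
  refine mul_le_mul_of_nonneg_right ?_ (sq_nonneg _)
  rw [← Finset.prod_pow]
  calc _ ≤ ∏ i : Fin k, (R ^ 4) ^ (k + l) := by
        refine Finset.prod_le_prod (fun _ _ => sq_nonneg _) fun i _ => ?_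
        rw [← Finset.prod_pow]
        calc _ ≤ ∏ j : Fin (k + l), R ^ 4 :=
              Finset.prod_le_prod (fun _ _ => sq_nonneg _) fun j _ => hfac _ j
          _ = _ := by simp
    _ = _ := by simp [← pow_mul, mul_assoc]

lemma setLIntegral_VdM_le (k l : ℕ) {t R a b : ℝ} (ht : 0 < t) (hR : 1 ≤ R)
    (S : Set (Fin (k + l) → ℝ)) (hS : MeasurableSet S)
    (hpos : ∀ μ ∈ S, ∀ i, 0 ≤ μ i ∧ μ i ≤ R) (ha : ∀ μ ∈ S, a ≤ ∑ i, μ i ^ 2)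
    (hb : ∀ μ ∈ S, ∑ i : Fin l, μ (Fin.natAdd k i) ^ 2 ≤ b) :
    ∫⁻ μ in S, ENNReal.ofReal (VdM (k + l) μ ^ 2 * Real.exp (-(∑ j, μ j ^ 2) / 2)) ≤
      ENNReal.ofReal (Real.exp (-a / 2) * Real.exp (t * b / 2) * R ^ (4 * ((k + l) * k)) * R ^ k *
        ((Real.sqrt t ^ (l + 2 * (l * (l - 1))))⁻¹ * gaussVdM l)) := by
  set A : ℝ := Real.exp (-a / 2) * Real.exp (t * b / 2) * R ^ (4 * ((k + l) * k)) with hA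
  have hA0 : 0 ≤ A := by positivity
  set B : Set (Fin k → ℝ) := Set.Icc 0 (fun _ => R) with hB
  have hBm : MeasurableSet B := measurableSet_Icc
  set g : (Fin l → ℝ) → ENNReal := fun μ =>
    ENNReal.ofReal (VdM l μ ^ 2 * Real.exp (-(t * ∑ j, μ j ^ 2) / 2)) with hg
  have hgm : Measurable g := by
    have := (continuous_VdM l).measurable
    fun_prop
  have hbound : ∀ μ ∈ S,
      ENNReal.ofReal (VdM (k + l) μ ^ 2 * Real.exp (-(∑ j, μ j ^ 2) / 2)) ≤
        ENNReal.ofReal A * (B.indicator 1 (fun i => μ (Fin.castAdd l i)) *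
          g (fun i => μ (Fin.natAdd k i))) := by
    intro μ hμ
    have hmem : (fun i => μ (Fin.castAdd l i)) ∈ B :=
      ⟨fun i => (hpos μ hμ _).1, fun i => (hpos μ hμ _).2⟩
    rw [Set.indicator_of_mem hmem, Pi.one_apply, one_mul, hg, ← ENNReal.ofReal_mul hA0]
    apply ENNReal.ofReal_le_ofReal
    set T := ∑ i : Fin l, μ (Fin.natAdd k i) ^ 2
    have h1 : Real.exp (-(∑ j, μ j ^ 2) / 2) ≤
        Real.exp (-a / 2) * Real.exp (t * b / 2) * Real.exp (-(t * T) / 2) := by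
      rw [← Real.exp_add, ← Real.exp_add, Real.exp_le_exp]
      have := mul_le_mul_of_nonneg_left (hb μ hμ) ht.le
      linarith [ha μ hμ]
    calc _ ≤ (R ^ (4 * ((k + l) * k)) * VdM l (fun i => μ (Fin.natAdd k i)) ^ 2) *
          (Real.exp (-a / 2) * Real.exp (t * b / 2) * Real.exp (-(t * T) / 2)) :=
          mul_le_mul (VdM_sq_le k l hR μ (hpos μ hμ)) h1 (by positivity) (by positivity)
      _ = _ := by rw [hA]; ring
  calc _ ≤ ∫⁻ μ in S, ENNReal.ofReal A * (B.indicator 1 (fun i => μ (Fin.castAdd l i)) *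
          g (fun i => μ (Fin.natAdd k i))) := setLIntegral_mono' hS hbound
    _ ≤ ∫⁻ μ : Fin (k + l) → ℝ, ENNReal.ofReal A * (B.indicator 1 (fun i => μ (Fin.castAdd l i)) *
          g (fun i => μ (Fin.natAdd k i))) := setLIntegral_le_lintegral _ _
    _ = ENNReal.ofReal A * (ENNReal.ofReal (R ^ k) *
          ENNReal.ofReal ((Real.sqrt t ^ (l + 2 * (l * (l - 1))))⁻¹ * gaussVdM l)) := by
        rw [lintegral_const_mul' _ _ ENNReal.ofReal_ne_top,
          lintegral_fin_add_mul k l (measurable_one.indicator hBm) hgm,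
          lintegral_indicator_one hBm, hg, lintegral_VdM_sq_mul_exp_scaled l ht, hB,
          Real.volume_Icc_pi]
        simp [ENNReal.ofReal_pow (zero_le_one.trans hR)]
    _ = _ := by
        rw [← ENNReal.ofReal_mul (by positivity), ← ENNReal.ofReal_mul hA0]
        congr 1
        ring

/-- The unnormalized law of `μ` on `ℝ^M` with density `z Δ(μ)² e^{-Σ μ_j²/2}` on `Σ`. -/
def weylMeasure (M : ℕ) (z : ℝ) : Measure (Fin M → ℝ) :=
  (volume.restrict (SigmaN M)).withDensity
    (fun μ => ENNReal.ofReal (z * (VdM M μ) ^ 2 * Real.exp (-(∑ j, μ j ^ 2) / 2)))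

lemma isOpen_SigmaN (M : ℕ) : IsOpen (SigmaN M) := by
  have : SigmaN M = (⋂ i : Fin M, ⋂ j : Fin M, {μ | i < j → μ j < μ i}) ∩
      ⋂ i : Fin M, {μ | 0 < μ i} := by
    ext μ
    simp [SigmaN]
  rw [this]
  refine (isOpen_iInter_of_finite fun i => isOpen_iInter_of_finite fun j => ?_).inter
    (isOpen_iInter_of_finite fun i => isOpen_lt continuous_const (continuous_apply i))
  by_cases h : i < j
  · simpa [h] using isOpen_lt (continuous_apply j) (continuous_apply i)
  · simp [h]

lemma weylMeasure_apply (M : ℕ) (z : ℝ) {S : Set (Fin M → ℝ)} (hS : MeasurableSet S)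
    (hSub : S ⊆ SigmaN M) :
    weylMeasure M z S =
      ∫⁻ μ in S, ENNReal.ofReal (z * (VdM M μ) ^ 2 * Real.exp (-(∑ j, μ j ^ 2) / 2)) := by
  rw [weylMeasure, withDensity_apply _ hS, Measure.restrict_restrict hS,
    Set.inter_eq_self_of_subset_left hSub]

lemma memX.nonneg {x : ℕ →ᵇ ℝ} (hx : memX x) (j : ℕ) : 0 ≤ x (j + 1) := by
  rcases j with _ | j
  · exact (hx.1 1 le_rfl).1.trans (hx.1 1 le_rfl).2
  · exact (hx.1 (j + 1) (by omega)).1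

lemma memX.antitone {x : ℕ →ᵇ ℝ} (hx : memX x) : Antitone fun j => x (j + 1) :=
  antitone_nat_of_succ_le fun j => (hx.1 (j + 1) (by omega)).2

/-- `J_k = x_0 - Σ_{j=1}^k x_j²` up to an `ε`-error. -/
def truncJ (x : ℕ →ᵇ ℝ) (k : ℕ) (ε : ℝ) : ℝ :=
  x 0 + ε - ∑ j ∈ Finset.range k, (x (j + 1) ^ 2 - 2 * ε * x (j + 1))

lemma weylMeasure_ball_le {M k l : ℕ} (hM : M = k + l) {z c ε t R : ℝ} (hz : 0 ≤ z) (hc : 0 < c)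
    (ht : 0 < t) (g : (Fin M → ℝ) → (ℕ →ᵇ ℝ))
    (hg0 : ∀ μ ∈ SigmaN M, g μ 0 = c⁻¹ * ∑ j, μ j ^ 2)
    (hg : ∀ μ ∈ SigmaN M, ∀ j : Fin M, g μ ((j : ℕ) + 1) = (Real.sqrt c)⁻¹ * μ j)
    {x : ℕ →ᵇ ℝ} (hx : memX x) (hR : 1 ≤ R) (hRx : Real.sqrt c * (‖x‖ + ε) ≤ R) :
    weylMeasure M z {μ | dist (g μ) x < ε} ≤
      ENNReal.ofReal (z * (Real.exp (-(c * (x 0 - ε)) / 2) *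
        Real.exp (t * (c * truncJ x k ε) / 2) * R ^ (4 * ((k + l) * k)) * R ^ k *
        ((Real.sqrt t ^ (l + 2 * (l * (l - 1))))⁻¹ * gaussVdM l))) := by
  subst hM
  have hsc : 0 < Real.sqrt c := Real.sqrt_pos.2 hc
  set S : Set (Fin (k + l) → ℝ) := SigmaN (k + l) ∩ {μ | (∀ i, μ i ≤ R) ∧
    c * (x 0 - ε) ≤ ∑ i, μ i ^ 2 ∧
    ∑ i : Fin l, μ (Fin.natAdd k i) ^ 2 ≤ c * truncJ x k ε} with hS
  have hSm : MeasurableSet S := by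
    refine (isOpen_SigmaN _).measurableSet.inter (IsClosed.measurableSet ?_)
    simp only [Set.ofPred_and, Set.ofPred_forall]
    refine (isClosed_iInter fun i => isClosed_le (by fun_prop) (by fun_prop)).inter
      ((isClosed_le (by fun_prop) (by fun_prop)).inter (isClosed_le (by fun_prop) (by fun_prop)))
  have hsub : weylMeasure (k + l) z {μ | dist (g μ) x < ε} ≤ weylMeasure (k + l) z S := by
    refine measure_mono_ae ?_
    have hae : ∀ᵐ μ ∂(weylMeasure (k + l) z), μ ∈ SigmaN (k + l) :=
      (withDensity_absolutelyContinuous _ _).ae_le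
        (ae_restrict_mem (isOpen_SigmaN _).measurableSet)
    filter_upwards [hae] with μ hμ hd
    have hd : dist (g μ) x < ε := hd
    have hclose : ∀ j, |g μ j - x j| < ε := fun j => by
      rw [← Real.dist_eq]
      exact (BoundedContinuousFunction.dist_coe_le_dist j).trans_lt hd
    have hμg : ∀ j : Fin (k + l), μ j = Real.sqrt c * g μ ((j : ℕ) + 1) := fun j => by
      rw [hg μ hμ j, mul_inv_cancel_left₀ hsc.ne']
    have hsum : ∑ j, μ j ^ 2 = c * g μ 0 := by rw [hg0 μ hμ, mul_inv_cancel_left₀ hc.ne']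
    refine ⟨hμ, fun i => ?_, ?_, ?_⟩
    · rw [hμg]
      refine le_trans (mul_le_mul_of_nonneg_left ?_ hsc.le) hRx
      have h1 := (abs_lt.1 (hclose ((i : ℕ) + 1))).2
      have h2 := (le_abs_self _).trans (x.norm_coe_le_norm ((i : ℕ) + 1))
      linarith
    · rw [hsum]
      exact mul_le_mul_of_nonneg_left (by linarith [(abs_lt.1 (hclose 0)).1]) hc.le
    · rw [Fin.sum_univ_add] at hsum
      have hfirst : c * ∑ j ∈ Finset.range k, (x (j + 1) ^ 2 - 2 * ε * x (j + 1)) ≤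
          ∑ i : Fin k, μ (Fin.castAdd l i) ^ 2 := by
        rw [Finset.sum_range, Finset.mul_sum]
        refine Finset.sum_le_sum fun i _ => ?_
        rw [hμg, mul_pow, Real.sq_sqrt hc.le]
        refine mul_le_mul_of_nonneg_left ?_ hc.le
        have h1 := (abs_lt.1 (hclose ((i : ℕ) + 1))).1
        have h2 := hx.nonneg i
        simp only [Fin.val_castAdd]
        nlinarith [sq_nonneg (g μ ((i : ℕ) + 1) - x ((i : ℕ) + 1))]
      have h0 := mul_le_mul_of_nonneg_left (abs_lt.1 (hclose 0)).2.le hc.le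
      rw [truncJ]
      linarith
  refine hsub.trans ?_
  rw [weylMeasure_apply _ _ hSm Set.inter_subset_left]
  simp only [mul_assoc z, ENNReal.ofReal_mul hz]
  rw [lintegral_const_mul' _ _ ENNReal.ofReal_ne_top]
  refine mul_le_mul_right ?_ _
  exact setLIntegral_VdM_le k l ht hR S hSm (fun μ hμ i => ⟨(hμ.1.2 i).le, hμ.2.1 i⟩)
    (fun μ hμ => hμ.2.2.1) (fun μ hμ => hμ.2.2.2)

lemma VdM_ne_zero {M : ℕ} {μ : Fin M → ℝ} (hμ : μ ∈ SigmaN M) : VdM M μ ≠ 0 := by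
  rw [VdM, Finset.prod_ne_zero_iff]
  intro p hp
  have hlt := hμ.1 p.1 p.2 (Finset.mem_filter.1 hp).2
  exact (sub_pos.2 (pow_lt_pow_left₀ hlt (hμ.2 p.2).le two_ne_zero)).ne'

lemma weylMeasure_ball_pos {M : ℕ} {z c ε δ : ℝ} (hz : 0 < z) (hc : 0 < c) (hδ : δ < ε)
    (hδ0 : 0 ≤ δ)
    (g : (Fin M → ℝ) → (ℕ →ᵇ ℝ))
    (hg0 : ∀ μ ∈ SigmaN M, g μ 0 = c⁻¹ * ∑ j, μ j ^ 2)
    (hg : ∀ μ ∈ SigmaN M, ∀ j : Fin M, g μ ((j : ℕ) + 1) = (Real.sqrt c)⁻¹ * μ j)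
    (hgz : ∀ μ ∈ SigmaN M, ∀ j : ℕ, M < j → g μ j = 0)
    {x : ℕ →ᵇ ℝ} (hxz : ∀ j : ℕ, M < j → |x j| ≤ δ) {y : Fin M → ℝ} (hy : y ∈ SigmaN M)
    (hyx : ∀ j : Fin M, |y j - x ((j : ℕ) + 1)| < δ) (hy0 : |∑ j, y j ^ 2 - x 0| < δ) :
    0 < weylMeasure M z {μ | dist (g μ) x < ε} := by
  have hsc : 0 < Real.sqrt c := Real.sqrt_pos.2 hc
  set U : Set (Fin M → ℝ) := SigmaN M ∩ {μ | |c⁻¹ * ∑ j, μ j ^ 2 - x 0| < δ ∧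
    ∀ j : Fin M, |(Real.sqrt c)⁻¹ * μ j - x ((j : ℕ) + 1)| < δ} with hU
  have hUo : IsOpen U := by
    refine (isOpen_SigmaN M).inter ?_
    simp only [Set.ofPred_and, Set.ofPred_forall]
    exact (isOpen_lt (by fun_prop) (by fun_prop)).inter
      (isOpen_iInter_of_finite fun j => isOpen_lt (by fun_prop) (by fun_prop))
  have hUne : U.Nonempty := by
    refine ⟨Real.sqrt c • y, ⟨fun i j hij => ?_, fun i => ?_⟩, ?_, fun j => ?_⟩
    · exact mul_lt_mul_of_pos_left (hy.1 i j hij) hsc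
    · exact mul_pos hsc (hy.2 i)
    · simp only [Pi.smul_apply, smul_eq_mul, mul_pow, Real.sq_sqrt hc.le, ← Finset.mul_sum]
      rwa [inv_mul_cancel_left₀ hc.ne']
    · simp only [Pi.smul_apply, smul_eq_mul]
      rw [inv_mul_cancel_left₀ hsc.ne']
      exact hyx j
  have hsub : U ⊆ {μ | dist (g μ) x < ε} := by
    rintro μ ⟨hμ, h0, h1⟩
    refine lt_of_le_of_lt ((BoundedContinuousFunction.dist_le hδ0).2 fun j => ?_) hδ
    rw [Real.dist_eq]
    rcases j with _ | j
    · rw [hg0 μ hμ]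
      exact h0.le
    · rcases lt_or_ge j M with hj | hj
      · have := hg μ hμ ⟨j, hj⟩
        simp only at this
        rw [this]
        exact (h1 ⟨j, hj⟩).le
      · rw [hgz μ hμ _ (by omega), zero_sub, abs_neg]
        exact hxz _ (by omega)
  refine lt_of_lt_of_le ?_ (measure_mono hsub)
  rw [weylMeasure_apply _ _ hUo.measurableSet Set.inter_subset_left, setLIntegral_pos_iff]
  · rw [Set.inter_eq_self_of_subset_right]
    · exact hUo.measure_pos _ hUne
    · intro μ hμ
      have hV := VdM_ne_zero hμ.1
      rw [Function.mem_support]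
      exact (ENNReal.ofReal_pos.2 (by positivity)).ne'
  · have := (continuous_VdM M).measurable
    fun_prop

lemma eventually_exists_mem_SigmaN_near {x : ℕ →ᵇ ℝ} (hx : memX x) {δ : ℝ} (hδ : 0 < δ) :
    ∀ᶠ m : ℕ in atTop, (∀ j : ℕ, m < j → |x j| ≤ δ) ∧ ∃ y ∈ SigmaN m,
      (∀ j : Fin m, |y j - x ((j : ℕ) + 1)| < δ) ∧ |∑ j, y j ^ 2 - x 0| < δ := by
  obtain ⟨-, hsum, hle⟩ := id hx
  set J : ℝ := Jfun x with hJ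
  have hJ0 : 0 ≤ J := sub_nonneg.2 hle
  have hpart : Tendsto (fun m => ∑ j ∈ Finset.range m, x (j + 1) ^ 2) atTop
      (nhds (∑' j : ℕ, x (j + 1) ^ 2)) := hsum.hasSum.tendsto_sum_nat
  have hinv : Tendsto (fun m : ℕ => (1 : ℝ) / m) atTop (nhds 0) := tendsto_one_div_atTop_nhds_zero_nat
  have hsmall : Tendsto (fun m : ℕ => (J + 1) * ((1 : ℝ) / m)) atTop (nhds 0) := by
    simpa using hinv.const_mul (J + 1)
  have hsq0 : Tendsto (fun j => x (j + 1) ^ 2) atTop (nhds 0) := hsum.tendsto_atTop_zero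
  filter_upwards [eventually_gt_atTop 0, hsmall.eventually_lt_const (show 0 < δ ^ 2 by positivity),
    hinv.eventually_lt_const (half_pos hδ),
    hsq0.eventually_lt_const (show 0 < δ ^ 2 by positivity),
    hpart.eventually (Metric.ball_mem_nhds _ (half_pos hδ))] with m hm h1 h2 h3 h4
  have hm' : (0 : ℝ) < m := by exact_mod_cast hm
  have hm1 : (1 : ℝ) ≤ m := by exact_mod_cast hm
  refine ⟨fun j hj => ?_, ?_⟩
  · obtain ⟨i, rfl⟩ : ∃ i, j = i + 1 := ⟨j - 1, by omega⟩
    rw [abs_of_nonneg (hx.nonneg i)]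
    exact (hx.antitone (show m ≤ i by omega)).trans (lt_of_pow_lt_pow_left₀ 2 hδ.le h3).le
  set r : Fin m → ℝ := fun j => J / m + (m - (j : ℕ)) / (m : ℝ) ^ 3 with hr
  have hjm : ∀ j : Fin m, ((j : ℕ) : ℝ) < m := fun j => by exact_mod_cast j.2
  have hterm0 : ∀ j : Fin m, 0 < (m - (j : ℕ)) / (m : ℝ) ^ 3 := fun j =>
    div_pos (sub_pos.2 (hjm j)) (by positivity)
  have hterm1 : ∀ j : Fin m, (m - (j : ℕ)) / (m : ℝ) ^ 3 ≤ 1 / (m : ℝ) ^ 2 := fun j => by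
    rw [div_le_div_iff₀ (by positivity) (by positivity)]
    have : (0 : ℝ) ≤ (j : ℕ) := Nat.cast_nonneg _
    have h2 : (0 : ℝ) < (m : ℝ) ^ 2 := by positivity
    nlinarith
  have hr0 : ∀ j, 0 < r j := fun j => add_pos_of_nonneg_of_pos (by positivity) (hterm0 j)
  have hr1 : ∀ j, r j ≤ (J + 1) * (1 / m) := fun j => by
    have h : 1 / (m : ℝ) ^ 2 ≤ 1 / m := by
      apply one_div_le_one_div_of_le hm'
      nlinarith
    have := (hterm1 j).trans h
    calc r j ≤ J / m + 1 / m := by simp only [hr]; linarith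
      _ = _ := by ring
  have hsqrt : ∀ j : Fin m, Real.sqrt (x ((j : ℕ) + 1) ^ 2 + r j) ^ 2 =
      x ((j : ℕ) + 1) ^ 2 + r j := fun j => Real.sq_sqrt (by have := hr0 j; positivity)
  refine ⟨fun j => Real.sqrt (x ((j : ℕ) + 1) ^ 2 + r j), ⟨fun i j hij => ?_, fun i => ?_⟩,
    fun j => ?_, ?_⟩
  · apply Real.sqrt_lt_sqrt (by have := hr0 j; positivity)
    have hij' : ((i : ℕ) : ℝ) < (j : ℕ) := by exact_mod_cast hij
    refine add_lt_add_of_le_of_lt (pow_le_pow_left₀ (hx.nonneg _) (hx.antitone hij.le) 2) ?_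
    simp only [hr]
    gcongr
  · exact Real.sqrt_pos.2 (by have := hr0 i; positivity)
  · have hxj := hx.nonneg j
    have hlow : x ((j : ℕ) + 1) ≤ Real.sqrt (x ((j : ℕ) + 1) ^ 2 + r j) :=
      Real.le_sqrt_of_sq_le (by linarith [hr0 j])
    rw [abs_of_nonneg (by linarith), sub_lt_iff_lt_add, Real.sqrt_lt' (by positivity)]
    nlinarith [hr1 j, hr0 j]
  · simp only [hsqrt]
    have hrsum : ∑ j, r j = J + ∑ j : Fin m, (m - (j : ℕ)) / (m : ℝ) ^ 3 := by
      simp only [hr, Finset.sum_add_distrib, Finset.sum_const, Finset.card_univ, Fintype.card_fin,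
        nsmul_eq_mul]
      rw [mul_div_cancel₀ _ hm'.ne']
    have hs0 : 0 ≤ ∑ j : Fin m, (m - (j : ℕ)) / (m : ℝ) ^ 3 :=
      Finset.sum_nonneg fun j _ => (hterm0 j).le
    have hs1 : ∑ j : Fin m, (m - (j : ℕ)) / (m : ℝ) ^ 3 ≤ 1 / m := by
      calc _ ≤ ∑ _j : Fin m, 1 / (m : ℝ) ^ 2 := Finset.sum_le_sum fun j _ => hterm1 j
        _ = 1 / m := by
          simp only [Finset.sum_const, Finset.card_univ, Fintype.card_fin, nsmul_eq_mul]
          field_simp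
    rw [Finset.sum_add_distrib, hrsum, ← Finset.sum_range (fun j => x (j + 1) ^ 2)]
    rw [Real.dist_eq, abs_lt] at h4
    have hJx : x 0 = J + ∑' j : ℕ, x (j + 1) ^ 2 := by rw [hJ, Jfun]; ring
    rw [abs_lt]
    constructor <;> linarith [h4.1, h4.2]

lemma gaussVdM_le (l m : ℕ) (hlm : l ≤ m) :
    gaussVdM l ≤ (3 * (m : ℝ)) ^ m * Zn (2 * m) := by
  have hprod : ∏ j ∈ Finset.range l, ((2 * j).factorial : ℝ) ≤
      ∏ j ∈ Finset.range m, ((2 * j).factorial : ℝ) := by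
    exact_mod_cast Finset.prod_le_prod_of_subset_of_one_le' (Finset.range_mono hlm)
      fun j _ _ => Nat.factorial_pos (2 * j)
  have hZ : ∏ j ∈ Finset.range m, ((2 * j).factorial : ℝ) ≤ Zn (2 * m) := by
    rw [Zn, Nat.mul_div_cancel_left m two_pos]
    refine le_mul_of_one_le_left (Finset.prod_nonneg fun j _ => by positivity) ?_
    exact Real.one_le_rpow (by linarith [Real.pi_gt_three]) (by positivity)
  have hsqrt : Real.sqrt (2 * Real.pi) ≤ 3 := by
    rw [Real.sqrt_le_left (by norm_num)]
    linarith [Real.pi_lt_four]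
  have hfact : (l.factorial : ℝ) ≤ (m : ℝ) ^ m := by
    exact_mod_cast (Nat.factorial_le hlm).trans (Nat.factorial_le_pow m)
  have h3 : Real.sqrt (2 * Real.pi) ^ l ≤ 3 ^ m :=
    (pow_le_pow_left₀ (Real.sqrt_nonneg _) hsqrt l).trans (pow_le_pow_right₀ (by norm_num) hlm)
  rw [gaussVdM, Finset.prod_mul_distrib, Finset.prod_const, Finset.card_range, mul_pow]
  calc _ ≤ (m : ℝ) ^ m * (3 ^ m * Zn (2 * m)) := by
        gcongr
        exact hprod.trans hZ
    _ = _ := by ring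

lemma Zn_pos (n : ℕ) : 0 < Zn n := by
  have := Real.pi_pos
  unfold Zn
  positivity

/-- Upper bound for `ln P(d(γ_n, x) < ε)` with `n = 2m`. -/
def logBound (x : ℕ →ᵇ ℝ) (k : ℕ) (ε t : ℝ) (m : ℕ) : ℝ :=
  ((m : ℝ) ^ 2 - m / 2) * (t * truncJ x k ε - (x 0 - ε)) +
    k * (4 * m + 1) * Real.log (2 * m * (‖x‖ + 1)) -
    (((m : ℝ) - k) ^ 2 - (m - k) / 2) * Real.log t + m * Real.log (3 * m)

lemma Pn_ball_le {γ : (n : ℕ) → (Fin (n / 2) → ℝ) → (ℕ →ᵇ ℝ)} (hγ : IsGammaN γ)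
    {x : ℕ →ᵇ ℝ} (hx : memX x) (k : ℕ) {ε t : ℝ} (hε1 : ε ≤ 1) (ht : 0 < t)
    {m : ℕ} (hm : 0 < m) (hkm : k ≤ m) :
    Pn (2 * m) {μ | dist (γ (2 * m) μ) x < ε} ≤
      ENNReal.ofReal (Real.exp (logBound x k ε t m)) := by
  have hm' : (1 : ℝ) ≤ m := by exact_mod_cast hm
  obtain ⟨l, rfl⟩ := Nat.exists_eq_add_of_le hkm
  set m := k + l with hmdef
  have hc : (((2 * m).choose 2 : ℕ) : ℝ) = m * (2 * m - 1) := by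
    rw [Nat.cast_choose_two]
    push_cast
    ring
  have hc0 : 0 < (((2 * m).choose 2 : ℕ) : ℝ) := by
    rw [hc]
    nlinarith
  have hx0 : 0 ≤ ‖x‖ := norm_nonneg x
  set R : ℝ := 2 * m * (‖x‖ + 1) with hRdef
  have hR : 1 ≤ R := by
    rw [hRdef]
    nlinarith
  have hRx : Real.sqrt ((2 * m).choose 2 : ℕ) * (‖x‖ + ε) ≤ R := by
    refine (mul_le_mul_of_nonneg_left (show ‖x‖ + ε ≤ ‖x‖ + 1 by linarith)
      (Real.sqrt_nonneg _)).trans (mul_le_mul_of_nonneg_right ?_ (by linarith))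
    rw [Real.sqrt_le_left (by linarith), hc]
    nlinarith
  have hγ' := hγ (2 * m) (even_two_mul m) (by omega)
  have hZ := Zn_pos (2 * m)
  have hbound := weylMeasure_ball_le (M := 2 * m / 2) (k := k) (l := l) (by omega)
    (inv_nonneg.2 hZ.le) hc0 ht (γ (2 * m)) (fun μ hμ => (hγ' μ hμ).2.1)
    (fun μ hμ => (hγ' μ hμ).2.2.1) hx hR hRx
  refine hbound.trans (ENNReal.ofReal_le_ofReal ?_)
  have hs : 0 < Real.sqrt t := Real.sqrt_pos.2 ht
  have hl : (((l + 2 * (l * (l - 1)) : ℕ)) : ℝ) = 2 * (l : ℝ) ^ 2 - l := by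
    rcases l with _ | l
    · simp
    · push_cast [Nat.add_sub_cancel]
      ring
  have hpow : ∀ (y : ℝ) (n : ℕ), 0 < y → y ^ n = Real.exp (n * Real.log y) := fun y n hy => by
    rw [← Real.log_pow, Real.exp_log (by positivity)]
  calc _ = (Real.exp (-(((2 * m).choose 2 : ℕ) * (x 0 - ε)) / 2) *
          Real.exp (t * (((2 * m).choose 2 : ℕ) * truncJ x k ε) / 2) * R ^ (4 * (m * k)) * R ^ k *
          (Real.sqrt t ^ (l + 2 * (l * (l - 1))))⁻¹) * ((Zn (2 * m))⁻¹ * gaussVdM l) := by ring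
    _ ≤ (Real.exp (-(((2 * m).choose 2 : ℕ) * (x 0 - ε)) / 2) *
          Real.exp (t * (((2 * m).choose 2 : ℕ) * truncJ x k ε) / 2) * R ^ (4 * (m * k)) * R ^ k *
          (Real.sqrt t ^ (l + 2 * (l * (l - 1))))⁻¹) * (3 * (m : ℝ)) ^ m := by
        refine mul_le_mul_of_nonneg_left ?_ (by positivity)
        rw [inv_mul_le_iff₀ hZ, mul_comm]
        exact gaussVdM_le l m (by omega)
    _ = _ := by
        rw [hpow R _ (by positivity), hpow R _ (by positivity), hpow (Real.sqrt t) _ hs,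
          hpow (3 * (m : ℝ)) _ (by positivity), ← Real.exp_neg, ← Real.exp_add, ← Real.exp_add,
          ← Real.exp_add, ← Real.exp_add, ← Real.exp_add, hc, hl, Real.log_sqrt ht.le, logBound,
          ← hRdef]
        have hk : (m : ℝ) - k = l := by rw [hmdef]; push_cast; ring
        rw [hk]
        congr 1
        push_cast
        ring

lemma tendsto_logBound (x : ℕ →ᵇ ℝ) (k : ℕ) (ε t : ℝ) :
    Tendsto (fun m : ℕ => (4 / (2 * m : ℝ) ^ 2) * logBound x k ε t m) atTop
      (nhds (t * truncJ x k ε - (x 0 - ε) - Real.log t)) := by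
  have hu : Tendsto (fun m : ℕ => (1 : ℝ) / m) atTop (nhds 0) := tendsto_one_div_atTop_nhds_zero_nat
  have hv : Tendsto (fun m : ℕ => Real.log m / m) atTop (nhds 0) := by
    have h := (Real.isLittleO_log_id_atTop.tendsto_div_nhds_zero).comp
      (tendsto_natCast_atTop_atTop (R := ℝ))
    exact h
  set q := t * truncJ x k ε - (x 0 - ε) with hq
  set F : ℝ × ℝ → ℝ := fun p => (1 - p.1 / 2) * q +
    k * (4 + p.1) * (p.2 + p.1 * Real.log (2 * (‖x‖ + 1))) -
    ((1 - k * p.1) ^ 2 - p.1 * (1 - k * p.1) / 2) * Real.log t + (p.2 + p.1 * Real.log 3) with hF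
  have hFc : Continuous F := by fun_prop
  have hlim := (hFc.tendsto (0, 0)).comp (hu.prodMk_nhds hv)
  have hF0 : F (0, 0) = q - Real.log t := by simp [hF]
  rw [hF0] at hlim
  refine hlim.congr' ?_
  filter_upwards [eventually_gt_atTop 0] with m hm
  have hm' : (0 : ℝ) < m := by exact_mod_cast hm
  have hx1 : 0 < ‖x‖ + 1 := by positivity
  have hlog1 : Real.log (2 * m * (‖x‖ + 1)) = Real.log m + Real.log (2 * (‖x‖ + 1)) := by
    rw [← Real.log_mul hm'.ne' (by positivity)]
    ring_nf
  have hlog2 : Real.log (3 * m) = Real.log m + Real.log 3 := by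
    rw [← Real.log_mul hm'.ne' (by norm_num), mul_comm]
  simp only [Function.comp, hF, logBound, hlog1, hlog2, ← hq]
  field_simp
  ring

lemma eventually_Pn_ball_pos {γ : (n : ℕ) → (Fin (n / 2) → ℝ) → (ℕ →ᵇ ℝ)} (hγ : IsGammaN γ)
    {x : ℕ →ᵇ ℝ} (hx : memX x) {ε : ℝ} (hε : 0 < ε) :
    ∀ᶠ m : ℕ in atTop, 0 < Pn (2 * m) {μ | dist (γ (2 * m) μ) x < ε} := by
  filter_upwards [eventually_exists_mem_SigmaN_near hx (half_pos hε), eventually_gt_atTop 0]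
    with m hnear hm
  have hγ' := hγ (2 * m) (even_two_mul m) (by omega)
  have hc0 : 0 < (((2 * m).choose 2 : ℕ) : ℝ) := by
    exact_mod_cast Nat.choose_pos (by omega)
  have hM : 2 * m / 2 = m := by omega
  rw [← hM] at hnear
  obtain ⟨hxz, y, hy, hyx, hy0⟩ := hnear
  exact weylMeasure_ball_pos (inv_pos.2 (Zn_pos (2 * m))) hc0 (half_lt_self hε) (half_pos hε).le
    (γ (2 * m)) (fun μ hμ => (hγ' μ hμ).2.1) (fun μ hμ => (hγ' μ hμ).2.2.1)
    (fun μ hμ => (hγ' μ hμ).2.2.2) hxz hy hyx hy0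

lemma limsup_log_Pn_ball_le {γ : (n : ℕ) → (Fin (n / 2) → ℝ) → (ℕ →ᵇ ℝ)} (hγ : IsGammaN γ)
    {x : ℕ →ᵇ ℝ} (hx : memX x) (k : ℕ) {ε t : ℝ} (hε : 0 < ε) (hε1 : ε ≤ 1) (ht : 0 < t) :
    Filter.limsup (fun m : ℕ =>
        (((4 / (2 * m : ℝ) ^ 2) *
          Real.log ((Pn (2 * m) {μ | dist (γ (2 * m) μ) x < ε}).toReal) : ℝ) : EReal))
        Filter.atTop ≤ ((t * truncJ x k ε - (x 0 - ε) - Real.log t : ℝ) : EReal) := by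
  have hlim := (continuous_coe_real_ereal.tendsto _).comp (tendsto_logBound x k ε t)
  rw [← hlim.limsup_eq]
  refine limsup_le_limsup ?_
  filter_upwards [eventually_Pn_ball_pos hγ hx hε, eventually_gt_atTop 0, eventually_ge_atTop k]
    with m hpos hm hkm
  have hle := Pn_ball_le hγ hx k hε1 ht hm hkm
  have htop := ne_top_of_le_ne_top ENNReal.ofReal_ne_top hle
  simp only [Function.comp, EReal.coe_le_coe_iff]
  refine mul_le_mul_of_nonneg_left ?_ (by positivity)
  rw [Real.log_le_iff_le_exp (ENNReal.toReal_pos hpos.ne' htop)]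
  exact ENNReal.toReal_le_of_le_ofReal (Real.exp_pos _).le hle

lemma iInf_limsup_log_Pn_ball_le {γ : (n : ℕ) → (Fin (n / 2) → ℝ) → (ℕ →ᵇ ℝ)} (hγ : IsGammaN γ)
    {x : ℕ →ᵇ ℝ} (hx : memX x) {t : ℝ} (ht : 0 < t) :
    ⨅ (ε : ℝ) (_ : 0 < ε), Filter.limsup (fun m : ℕ =>
        (((4 / (2 * m : ℝ) ^ 2) *
          Real.log ((Pn (2 * m) {μ | dist (γ (2 * m) μ) x < ε}).toReal) : ℝ) : EReal))
        Filter.atTop ≤ ((t * Jfun x - x 0 - Real.log t : ℝ) : EReal) := by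
  have hk : Tendsto (fun k => ((t * truncJ x k 0 - x 0 - Real.log t : ℝ) : EReal)) atTop
      (nhds ((t * Jfun x - x 0 - Real.log t : ℝ) : EReal)) := by
    refine (continuous_coe_real_ereal.tendsto _).comp ?_
    refine (((Tendsto.const_mul t ?_).sub_const _).sub_const _)
    have := hx.2.1.hasSum.tendsto_sum_nat.const_sub (x 0)
    simpa [truncJ, Jfun] using this
  refine ge_of_tendsto' hk fun k => ?_
  have hcont : Continuous fun ε : ℝ =>
      ((t * truncJ x k ε - (x 0 - ε) - Real.log t : ℝ) : EReal) := by
    refine continuous_coe_real_ereal.comp ?_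
    unfold truncJ
    fun_prop
  have hε := (hcont.tendsto 0).mono_left (nhdsWithin_le_nhds (s := Set.Ioi 0))
  rw [sub_zero] at hε
  refine ge_of_tendsto hε ?_
  filter_upwards [Ioc_mem_nhdsGT (zero_lt_one (α := ℝ))] with ε hε
  exact (iInf₂_le ε hε.1).trans (limsup_log_Pn_ball_le hγ hx k hε.1 hε.2 ht)

theorem stmt13 (γ : (n : ℕ) → (Fin (n / 2) → ℝ) → (ℕ →ᵇ ℝ)) (hγ : IsGammaN γ)
    (x : ℕ →ᵇ ℝ) (hx : x ∈ setX) :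
    ⨅ (ε : ℝ) (_ : 0 < ε), Filter.limsup (fun m : ℕ =>
        (((4 / (2 * m : ℝ) ^ 2) *
          Real.log ((Pn (2 * m) {μ | dist (γ (2 * m) μ) x < ε}).toReal) : ℝ) : EReal))
        Filter.atTop
      ≤ -(Ifun x) := by
  have hx : memX x := hx
  rw [Ifun]
  split_ifs with hJ
  · refine (iInf_limsup_log_Pn_ball_le hγ hx (inv_pos.2 hJ)).trans_eq ?_
    rw [← EReal.coe_neg, inv_mul_cancel₀ hJ.ne', Real.log_inv]
    congr 1
    ring
  · have hJ0 : Jfun x = 0 := le_antisymm (not_lt.1 hJ) (sub_nonneg.2 hx.2.2)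
    rw [EReal.neg_top, le_bot_iff, EReal.eq_bot_iff_forall_lt]
    intro r
    refine (iInf_limsup_log_Pn_ball_le hγ hx (Real.exp_pos (1 - x 0 - r))).trans_lt ?_
    rw [hJ0, Real.log_exp, EReal.coe_lt_coe_iff]
    linarith
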